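/- Let (W,S) be a Coxeter system of rank 3 with S = {r,s,t}, in which rt = tr (the product rt has order 2) and the orders m_{sr} of sr and m_{st} of st both satisfy m_{sr} ≥ 4 and m_{st} ≥ 4 (possibly infinite). Then there is no element w of W admitting elements w₁, w₂ ∈ W with w = w₁·s·r, ℓ(w) = ℓ(w₁) + 2, and w = w₂·s·t, ℓ(w) = ℓ(w₂) + 2. -/

import Mathlib

open LaurentPolynomial

theorem Function.End.mul_apply {α : Type*} (f g : Function.End α) (x : α) :
    (f * g) x = f (g x) := rfl

namespace CoxeterSystem

variable {B W : Type*} [Group W] {M : CoxeterMatrix B} (cs : CoxeterSystem M W)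

open scoped Classical in
/-- The action of the `i`-th simple reflection on `W × ZMod 2` that conjugates the first component
and flips the second one exactly when the first is the simple reflection itself. -/
noncomputable def signedConj (i : B) : Function.End (W × ZMod 2) := fun p ↦
  (cs.simple i * p.1 * cs.simple i, p.2 + if p.1 = cs.simple i then 1 else 0)

open scoped Classical in
theorem signedConj_mul_pow_apply (i j : B) (k : ℕ) (t : W) (e : ZMod 2) :
    ((cs.signedConj i * cs.signedConj j) ^ k) (t, e) =
      ((cs.simple i * cs.simple j) ^ k * t * (cs.simple j * cs.simple i) ^ k,
        e + ∑ l ∈ Finset.range (2 * k),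
          if t = (cs.simple j * cs.simple i) ^ l * cs.simple j then 1 else 0) := by
  induction k with
  | zero => simp; rfl
  | succ k ih =>
    rw [pow_succ', Function.End.mul_apply, ih]
    set a := cs.simple i with ha
    set b := cs.simple j with hb
    have hab : a * b = (b * a)⁻¹ := by
      rw [mul_inv_rev, ha, hb, cs.inv_simple, cs.inv_simple]
    have hcomm : ∀ n : ℕ, b * ((b * a) ^ n)⁻¹ = (b * a) ^ n * b := by
      intro n
      have : SemiconjBy b (b * a)⁻¹ (b * a) := by
        rw [← hab]
        exact (mul_assoc b a b).symm
      have h := this.pow_right n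
      rwa [inv_pow] at h
    have hconj : ∀ x, (a * b) ^ k * t * (b * a) ^ k = x ↔
        t = (b * a) ^ k * x * ((b * a) ^ k)⁻¹ := by
      intro x
      rw [hab, inv_pow, eq_mul_inv_iff_mul_eq, mul_assoc, inv_mul_eq_iff_eq_mul]
    have hb_iff : (a * b) ^ k * t * (b * a) ^ k = b ↔ t = (b * a) ^ (2 * k) * b := by
      rw [hconj, two_mul, pow_add, mul_assoc, hcomm, mul_assoc]
    have ha_iff : b * ((a * b) ^ k * t * (b * a) ^ k) * b = a ↔
        t = (b * a) ^ (2 * k + 1) * b := by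
      have hb_inv : b⁻¹ = b := cs.inv_simple j
      rw [← eq_mul_inv_iff_mul_eq, ← eq_inv_mul_iff_mul_eq, hb_inv, hconj, ← mul_assoc b a b,
        mul_assoc _ (b * a * b), mul_assoc _ b, hcomm, show 2 * k + 1 = k + 1 + k by ring,
        pow_add, pow_succ]
      simp only [mul_assoc]
    rw [show 2 * (k + 1) = 2 * k + 1 + 1 by ring, Finset.sum_range_succ, Finset.sum_range_succ]
    simp only [Function.End.mul_apply, signedConj, ← ha, ← hb, hb_iff, ha_iff]
    refine Prod.ext ?_ ?_
    · simp only [pow_succ' (a * b), pow_succ (b * a), mul_assoc]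
    · simp only [add_assoc]

theorem isLiftable_signedConj : M.IsLiftable cs.signedConj := by
  classical
  intro i j
  funext ⟨t, e⟩
  rw [signedConj_mul_pow_apply, cs.simple_mul_simple_pow, cs.simple_mul_simple_pow', two_mul,
    Finset.sum_range_add]
  simp only [pow_add, cs.simple_mul_simple_pow', one_mul, mul_one]
  rw [CharTwo.add_self_eq_zero, add_zero]
  rfl

open scoped Classical in
theorem lift_signedConj_wordProd (ω : List B) (t : W) (e : ZMod 2) :
    cs.lift ⟨cs.signedConj, cs.isLiftable_signedConj⟩ (cs.wordProd ω) (t, e) =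
      (cs.wordProd ω * t * (cs.wordProd ω)⁻¹, e + ((cs.rightInvSeq ω).count t : ZMod 2)) := by
  induction ω with
  | nil => simp; rfl
  | cons i ω ih =>
    rw [wordProd_cons, map_mul, Function.End.mul_apply, ih, lift_apply_simple]
    have h : cs.wordProd ω * t * (cs.wordProd ω)⁻¹ = cs.simple i ↔
        (cs.wordProd ω)⁻¹ * cs.simple i * cs.wordProd ω = t := by
      constructor
      · intro h
        rw [← h]; group
      · intro h
        rw [← h]; group
    simp only [signedConj, rightInvSeq, List.count_cons, h, beq_iff_eq]
    simp only [mul_inv_rev, inv_simple, mul_assoc, Nat.cast_add, Nat.cast_ite, Nat.cast_one, Nat.cast_zero, add_assoc]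

/-- The exchange property: a right descent of `π ω` occurs in the right inversion sequence
of `ω`. -/
theorem simple_mem_rightInvSeq_of_isRightDescent {ω : List B} {i : B}
    (h : cs.IsRightDescent (cs.wordProd ω) i) : cs.simple i ∈ cs.rightInvSeq ω := by
  classical
  obtain ⟨ω', hω', hprod⟩ := cs.exists_isReduced (cs.wordProd ω * cs.simple i)
  have heq : cs.wordProd (ω'.concat i) = cs.wordProd ω := by
    rw [wordProd_concat, ← hprod, simple_mul_simple_cancel_right]
  have hred : cs.IsReduced (ω'.concat i) := by
    have h1 := cs.isRightDescent_iff.mp h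
    rw [hprod, hω'.eq] at h1
    rw [IsReduced, heq, List.length_concat, h1]
  have hmem : cs.simple i ∈ cs.rightInvSeq (ω'.concat i) := by
    rw [rightInvSeq_concat]
    simp
  have h1 := cs.lift_signedConj_wordProd (ω'.concat i) (cs.simple i) 0
  rw [heq, lift_signedConj_wordProd, List.count_eq_one_of_mem hred.nodup_rightInvSeq hmem] at h1
  by_contra hn
  have h2 := congrArg Prod.snd h1
  simp [List.count_eq_zero_of_not_mem hn] at h2

/-- If `v = x (π ω)` with lengths adding, `i` is a right descent of `v`, and the exchange for `i`
does not take place inside `ω`, then it takes place inside `x`. -/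
theorem length_mul_simple_mul_inv_wordProd {v : W} {i : B} {ω : List B}
    (hv : cs.length (v * (cs.wordProd ω)⁻¹) + ω.length = cs.length v)
    (hi : cs.IsRightDescent v i) (hω : cs.simple i ∉ cs.rightInvSeq ω) :
    cs.length (v * cs.simple i * (cs.wordProd ω)⁻¹) + (ω.length + 1) = cs.length v := by
  obtain ⟨ω', hω', hprod⟩ := cs.exists_isReduced (v * (cs.wordProd ω)⁻¹)
  have heq : cs.wordProd (ω' ++ ω) = v := by
    rw [wordProd_append, ← hprod, inv_mul_cancel_right]
  have hmem : cs.simple i ∈ cs.rightInvSeq (ω' ++ ω) :=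
    cs.simple_mem_rightInvSeq_of_isRightDescent (heq.symm ▸ hi)
  obtain ⟨j, hj, hji⟩ := List.mem_iff_getElem.mp hmem
  have hdrop : cs.rightInvSeq ω = (cs.rightInvSeq (ω' ++ ω)).drop ω'.length := by
    rw [← rightInvSeq_drop, List.drop_left]
  have hlt : j < ω'.length := by
    by_contra! hle
    refine hω (hdrop ▸ List.mem_iff_getElem.mpr ⟨j - ω'.length, ?_, ?_⟩)
    · rw [List.length_drop]; omega
    · rw [List.getElem_drop, ← hji]
      congr 1; omega
  have herase := cs.wordProd_mul_getD_rightInvSeq (ω' ++ ω) j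
  rw [List.getD_eq_getElem _ _ hj, hji, heq, List.eraseIdx_append_of_lt_length hlt,
    wordProd_append] at herase
  have hle := cs.length_wordProd_le (ω'.eraseIdx j)
  rw [List.length_eraseIdx_of_lt hlt] at hle
  have hlen : cs.length (v * (cs.wordProd ω)⁻¹) = ω'.length := by rw [hprod, hω'.eq]
  have h1 := cs.length_mul_le (v * cs.simple i * (cs.wordProd ω)⁻¹) (cs.wordProd ω)
  rw [inv_mul_cancel_right] at h1
  have h2 := cs.length_wordProd_le ω
  have h3 := cs.isRightDescent_iff.mp hi
  rw [herase, mul_inv_cancel_right] at h1 ⊢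
  rw [herase] at h3
  omega

theorem length_mul_two_of_isRightDescent {v : W} {i j : B} (hi : cs.IsRightDescent v i)
    (hj : cs.IsRightDescent v j) (hij : cs.simple i ≠ cs.simple j) :
    cs.length (v * cs.simple i * cs.simple j) + 2 = cs.length v := by
  have := cs.length_mul_simple_mul_inv_wordProd (v := v) (i := i) (ω := [j])
    (by simpa using cs.isRightDescent_iff.mp hj) hi (by simpa using hij)
  simpa using this

theorem length_mul_three_of_isRightDescent {v : W} {i j : B} (hi : cs.IsRightDescent v i)
    (hj : cs.IsRightDescent v j) (hij : cs.simple i ≠ cs.simple j)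
    (hij2 : (cs.simple i * cs.simple j) ^ 2 ≠ 1) :
    cs.length (v * cs.simple i * cs.simple j * cs.simple i) + 3 = cs.length v := by
  have := cs.length_mul_simple_mul_inv_wordProd (v := v) (i := i) (ω := [i, j])
    (by simpa [wordProd_cons, mul_assoc] using
      cs.length_mul_two_of_isRightDescent hj hi hij.symm) hi (by
      simp only [rightInvSeq, wordProd_singleton, wordProd_nil, List.mem_cons, List.not_mem_nil,
        or_false, not_or, inv_simple, inv_one, one_mul, mul_one]
      refine ⟨fun h ↦ hij2 ?_, hij⟩
      rw [pow_two]
      nth_rewrite 1 [h]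
      simp [mul_assoc])
  simpa [wordProd_cons, mul_assoc] using this

theorem length_mul_four_of_isRightDescent {v : W} {i j : B} (hi : cs.IsRightDescent v i)
    (hj : cs.IsRightDescent v j) (hij : cs.simple i ≠ cs.simple j)
    (hij2 : (cs.simple i * cs.simple j) ^ 2 ≠ 1) (hij3 : (cs.simple i * cs.simple j) ^ 3 ≠ 1) :
    cs.length (v * cs.simple i * cs.simple j * cs.simple i * cs.simple j) + 4 =
      cs.length v := by
  have hji2 : (cs.simple j * cs.simple i) ^ 2 ≠ 1 := by
    rw [← inv_ne_one, ← inv_pow, mul_inv_rev, inv_simple, inv_simple]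
    exact hij2
  have := cs.length_mul_simple_mul_inv_wordProd (v := v) (i := i) (ω := [j, i, j])
    (by simpa [wordProd_cons, mul_assoc] using
      cs.length_mul_three_of_isRightDescent hj hi hij.symm hji2) hi (by
      simp only [rightInvSeq, wordProd_cons, wordProd_nil, List.mem_cons, List.not_mem_nil,
        or_false, not_or, inv_simple, inv_one, one_mul, mul_one, mul_inv_rev]
      refine ⟨fun h ↦ hij3 ?_, fun h ↦ hij2 ?_, hij⟩
      · rw [pow_succ', pow_two]
        nth_rewrite 1 [h]
        simp [mul_assoc]
      · rw [pow_two]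
        nth_rewrite 1 [h]
        simp [mul_assoc])
  simpa [wordProd_cons, mul_assoc] using this

theorem length_mul_four_of_orderOf {v : W} {i j : B} (hi : cs.IsRightDescent v i)
    (hj : cs.IsRightDescent v j)
    (h : orderOf (cs.simple j * cs.simple i) = 0 ∨ 4 ≤ orderOf (cs.simple j * cs.simple i)) :
    cs.length (v * cs.simple i * cs.simple j) + 2 = cs.length v ∧
    cs.length (v * cs.simple i * cs.simple j * cs.simple i * cs.simple j) + 4 =
      cs.length v := by
  have hinv : cs.simple j * cs.simple i = (cs.simple i * cs.simple j)⁻¹ := by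
    rw [mul_inv_rev, inv_simple, inv_simple]
  rw [hinv, orderOf_inv] at h
  have hpow : ∀ n, 0 < n → n < 4 → (cs.simple i * cs.simple j) ^ n ≠ 1 := by
    intro n hn hn4 h1
    have hdvd := orderOf_dvd_of_pow_eq_one h1
    rcases h with h | h
    · rw [h, zero_dvd_iff] at hdvd; omega
    · have := Nat.le_of_dvd hn hdvd; omega
  have hij : cs.simple i ≠ cs.simple j := fun hij ↦ hpow 1 (by omega) (by omega) (by simp [hij])
  exact ⟨cs.length_mul_two_of_isRightDescent hi hj hij,
    cs.length_mul_four_of_isRightDescent hi hj hij (hpow 2 (by omega) (by omega))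
      (hpow 3 (by omega) (by omega))⟩

end CoxeterSystem

/-- Lemma 4.4: if `m_{sr}, m_{st} ≥ 4`, there is no `w ∈ W` with
`w = (w₁)(sr) = (w₂)(st)`. -/
theorem no_element_sr_and_st
{W : Type*} [Group W] {M : CoxeterMatrix (Fin 3)} (cs : CoxeterSystem M W)
    (r s t : W) (hr : r = cs.simple 0) (hs : s = cs.simple 1) (ht : t = cs.simple 2)
    (hrt : orderOf (r * t) = 2)
    (hsr : orderOf (s * r) = 0 ∨ 4 ≤ orderOf (s * r))
    (hst : orderOf (s * t) = 0 ∨ 4 ≤ orderOf (s * t)) :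
    ¬ ∃ w w1 w2 : W,
        w = w1 * s * r ∧ cs.length w = cs.length w1 + 2 ∧
        w = w2 * s * t ∧ cs.length w = cs.length w2 + 2 := by
  subst hr hs ht
  have hne : cs.simple 0 ≠ cs.simple 2 := by
    intro h
    rw [h, cs.simple_mul_simple_self, orderOf_one] at hrt
    omega
  have hcomm : cs.simple 2 * cs.simple 0 = cs.simple 0 * cs.simple 2 := by
    have h : (cs.simple 0 * cs.simple 2) * (cs.simple 0 * cs.simple 2) = 1 := by
      rw [← pow_two]
      exact orderOf_dvd_iff_pow_eq_one.mp hrt.dvd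
    have h' := eq_inv_of_mul_eq_one_left h
    rw [mul_inv_rev, cs.inv_simple, cs.inv_simple] at h'
    exact h'.symm
  rintro ⟨w, w1, w2, h⟩
  induction hn : cs.length w using Nat.strong_induction_on generalizing w w1 w2 with
  | _ n ih =>
  subst hn
  obtain ⟨hw1, hl1, hw2, hl2⟩ := h
  have hwr : w * cs.simple 0 = w1 * cs.simple 1 := by
    rw [hw1, cs.simple_mul_simple_cancel_right]
  have hwt : w * cs.simple 2 = w2 * cs.simple 1 := by
    rw [hw2, cs.simple_mul_simple_cancel_right]
  have h1 := cs.length_mul_le w1 (cs.simple 1)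
  have h2 := cs.length_mul_le w2 (cs.simple 1)
  rw [cs.length_simple, ← hwr] at h1
  rw [cs.length_simple, ← hwt] at h2
  have hdr : cs.IsRightDescent w 0 := by unfold CoxeterSystem.IsRightDescent; omega
  have hdt : cs.IsRightDescent w 2 := by unfold CoxeterSystem.IsRightDescent; omega
  have hlr := cs.isRightDescent_iff.mp hdr
  have hlt := cs.isRightDescent_iff.mp hdt
  have hrt' := cs.length_mul_two_of_isRightDescent hdr hdt hne
  have htr' := cs.length_mul_two_of_isRightDescent hdt hdr hne.symm
  have hA := cs.length_mul_four_of_orderOf (v := w * cs.simple 2) (i := 0) (j := 1)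
    (by unfold CoxeterSystem.IsRightDescent; omega)
    (by
      unfold CoxeterSystem.IsRightDescent
      rw [show w * cs.simple 2 * cs.simple 1 = w2 by
        rw [hwt, cs.simple_mul_simple_cancel_right]]
      omega) hsr
  have hB := cs.length_mul_four_of_orderOf (v := w * cs.simple 0) (i := 2) (j := 1)
    (by unfold CoxeterSystem.IsRightDescent; omega)
    (by
      unfold CoxeterSystem.IsRightDescent
      rw [show w * cs.simple 0 * cs.simple 1 = w1 by
        rw [hwr, cs.simple_mul_simple_cancel_right]]
      omega) hst
  have hwrt : w * cs.simple 2 * cs.simple 0 = w * cs.simple 0 * cs.simple 2 := by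
    rw [mul_assoc, hcomm, mul_assoc]
  refine ih _ ?_ (w * cs.simple 2 * cs.simple 0 * cs.simple 1)
    (w * cs.simple 2 * cs.simple 0 * cs.simple 1 * cs.simple 0 * cs.simple 1)
    (w * cs.simple 0 * cs.simple 2 * cs.simple 1 * cs.simple 2 * cs.simple 1) ⟨?_, ?_, ?_, ?_⟩ rfl
  · omega
  · simp only [cs.simple_mul_simple_cancel_right]
  · omega
  · simp only [cs.simple_mul_simple_cancel_right, hwrt]
  · omega
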